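/- arXiv:1705.03826 — 5 statements merged into one kernel-verified Lean document; each statement's English description precedes it below -/
import Mathlib

section
/- In any Lie ring L, for all x₁, x₂, x₃, x₄ ∈ L the identity [x₁,x₂,x₃,x₄] + [x₃,x₄,x₁,x₂] + [x₂,x₁,x₄,x₃] + [x₄,x₃,x₂,x₁] = 0 holds, where brackets are left-normed. -/
/-- The Jacobi identity in left-normed form. -/
theorem lie_lie_sub_lie_lie_swap {L : Type*} [LieRing L] (a y z : L) :
    ⁅⁅a, y⁆, z⁆ - ⁅⁅a, z⁆, y⁆ = ⁅a, ⁅y, z⁆⁆ := by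
  rw [leibniz_lie a y z, ← lie_skew y ⁅a, z⁆, sub_eq_add_neg]

/-- In any Lie ring `L`, for all `x₁ x₂ x₃ x₄ : L` the identity
`[x₁,x₂,x₃,x₄] + [x₃,x₄,x₁,x₂] + [x₂,x₁,x₄,x₃] + [x₄,x₃,x₂,x₁] = 0` holds. -/
theorem jacobi_identity_four_1 {L : Type*} [LieRing L] (x₁ x₂ x₃ x₄ : L) :
    ⁅⁅⁅x₁, x₂⁆, x₃⁆, x₄⁆ + ⁅⁅⁅x₃, x₄⁆, x₁⁆, x₂⁆ + ⁅⁅⁅x₂, x₁⁆, x₄⁆, x₃⁆ +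
      ⁅⁅⁅x₄, x₃⁆, x₂⁆, x₁⁆ = 0 := by
  rw [← lie_skew x₂ x₁, ← lie_skew x₄ x₃]
  simp only [neg_lie]
  calc
    _ = (⁅⁅⁅x₁, x₂⁆, x₃⁆, x₄⁆ - ⁅⁅⁅x₁, x₂⁆, x₄⁆, x₃⁆) +
        (⁅⁅⁅x₃, x₄⁆, x₁⁆, x₂⁆ - ⁅⁅⁅x₃, x₄⁆, x₂⁆, x₁⁆) := by abel
    _ = ⁅⁅x₁, x₂⁆, ⁅x₃, x₄⁆⁆ + ⁅⁅x₃, x₄⁆, ⁅x₁, x₂⁆⁆ := by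
      rw [lie_lie_sub_lie_lie_swap, lie_lie_sub_lie_lie_swap]
    _ = 0 := by rw [← lie_skew ⁅x₁, x₂⁆ ⁅x₃, x₄⁆, neg_add_cancel]
end

section
/- In any Lie ring L, for all x₁, x₂, x₃, x₄ ∈ L the identity [x₁,x₂,x₃,x₄] + [x₃,x₁,x₂,x₄] + [x₄,x₁,x₂,x₃] + [x₁,x₄,x₃,x₂] + [x₂,x₃,x₄,x₁] = 0 holds, where brackets are left-normed. -/
theorem lie_lie_sub_lie_lie_right {L : Type*} [LieRing L] (u v w : L) :
    ⁅⁅u, v⁆, w⁆ - ⁅⁅u, w⁆, v⁆ = ⁅u, ⁅v, w⁆⁆ := by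
  rw [leibniz_lie u v w, ← lie_skew ⁅u, w⁆ v]
  abel

/-- In any Lie ring `L`, for all `x₁ x₂ x₃ x₄ : L` the identity
`[x₁,x₂,x₃,x₄] + [x₃,x₁,x₂,x₄] + [x₄,x₁,x₂,x₃] + [x₁,x₄,x₃,x₂] + [x₂,x₃,x₄,x₁] = 0` holds. -/
theorem jacobi_identity_four_2 {L : Type*} [LieRing L] (x₁ x₂ x₃ x₄ : L) :
    ⁅⁅⁅x₁, x₂⁆, x₃⁆, x₄⁆ + ⁅⁅⁅x₃, x₁⁆, x₂⁆, x₄⁆ + ⁅⁅⁅x₄, x₁⁆, x₂⁆, x₃⁆ +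
      ⁅⁅⁅x₁, x₄⁆, x₃⁆, x₂⁆ + ⁅⁅⁅x₂, x₃⁆, x₄⁆, x₁⁆ = 0 := by
  have cyclic : ⁅⁅x₁, x₂⁆, x₃⁆ + ⁅⁅x₃, x₁⁆, x₂⁆ = -⁅⁅x₂, x₃⁆, x₁⁆ := by
    rw [lie_skew, leibniz_lie x₁ x₂ x₃, ← lie_skew x₃ x₁, neg_lie, lie_skew]
  have left : ⁅⁅⁅x₁, x₂⁆, x₃⁆, x₄⁆ + ⁅⁅⁅x₃, x₁⁆, x₂⁆, x₄⁆ = -⁅⁅⁅x₂, x₃⁆, x₁⁆, x₄⁆ := by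
    rw [← add_lie, cyclic, neg_lie]
  have flip : ⁅⁅⁅x₁, x₄⁆, x₃⁆, x₂⁆ = -⁅⁅⁅x₄, x₁⁆, x₃⁆, x₂⁆ := by
    rw [← lie_skew x₁ x₄, neg_lie, neg_lie]
  calc _ = (⁅⁅⁅x₄, x₁⁆, x₂⁆, x₃⁆ - ⁅⁅⁅x₄, x₁⁆, x₃⁆, x₂⁆) +
        (⁅⁅⁅x₂, x₃⁆, x₄⁆, x₁⁆ - ⁅⁅⁅x₂, x₃⁆, x₁⁆, x₄⁆) := by
        rw [left, flip]; abel
    _ = 0 := by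
        rw [lie_lie_sub_lie_lie_right, lie_lie_sub_lie_lie_right,
          ← lie_skew ⁅x₄, x₁⁆, neg_add_cancel]
end

section
/- In any Lie ring L, for all x₁, x₂, x₃, x₄ ∈ L the identity [x₁,x₂,x₃,x₄] + [x₃,x₁,x₂,x₄] + [x₂,x₁,x₄,x₃] + [x₄,x₂,x₁,x₃] + [x₁,x₄,x₃,x₂] + [x₂,x₃,x₄,x₁] = 0 holds, where brackets are left-normed. -/
/-- In any Lie ring `L`, for all `x₁ x₂ x₃ x₄ : L` the identity
`[x₁,x₂,x₃,x₄] + [x₃,x₁,x₂,x₄] + [x₂,x₁,x₄,x₃] + [x₄,x₂,x₁,x₃] + [x₁,x₄,x₃,x₂]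
  + [x₂,x₃,x₄,x₁] = 0` holds. -/
theorem jacobi_identity_four_3 {L : Type*} [LieRing L] (x₁ x₂ x₃ x₄ : L) :
    ⁅⁅⁅x₁, x₂⁆, x₃⁆, x₄⁆ + ⁅⁅⁅x₃, x₁⁆, x₂⁆, x₄⁆ + ⁅⁅⁅x₂, x₁⁆, x₄⁆, x₃⁆ +
      ⁅⁅⁅x₄, x₂⁆, x₁⁆, x₃⁆ + ⁅⁅⁅x₁, x₄⁆, x₃⁆, x₂⁆ + ⁅⁅⁅x₂, x₃⁆, x₄⁆, x₁⁆ = 0 := by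
  have bracket_lie (a b c : L) : ⁅⁅a, b⁆, c⁆ = ⁅⁅c, b⁆, a⁆ - ⁅⁅c, a⁆, b⁆ := by
    rw [← lie_skew ⁅a, b⁆ c, leibniz_lie c a b, ← lie_skew a ⁅c, b⁆]
    abel
  rw [bracket_lie ⁅x₂, x₃⁆ x₄ x₁, bracket_lie x₄ x₂ x₁, ← lie_skew x₁ ⁅x₂, x₃⁆,
    bracket_lie x₂ x₃ x₁, ← lie_skew x₃ x₁, ← lie_skew x₂ x₁,
    ← lie_skew ⁅x₁, x₄⁆ ⁅x₂, x₃⁆, bracket_lie x₂ x₃ ⁅x₁, x₄⁆]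
  simp only [neg_lie, sub_lie]
  abel
end

section
/- In any Lie ring L, for all x₁, x₂, x₃, x₄ ∈ L the identity [x₁,x₂,x₃,x₄] + [x₃,x₁,x₂,x₄] + [x₂,x₁,x₄,x₃] + [x₄,x₂,x₁,x₃] + [x₁,x₃,x₄,x₂] + [x₃,x₄,x₁,x₂] + [x₂,x₃,x₄,x₁] = 0 holds, where brackets are left-normed. -/
/-- In any Lie ring `L`, for all `x₁ x₂ x₃ x₄ : L` the identity
`[x₁,x₂,x₃,x₄] + [x₃,x₁,x₂,x₄] + [x₂,x₁,x₄,x₃] + [x₄,x₂,x₁,x₃] + [x₁,x₃,x₄,x₂]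
  + [x₃,x₄,x₁,x₂] + [x₂,x₃,x₄,x₁] = 0` holds. -/
theorem jacobi_identity_four_4 {L : Type*} [LieRing L] (x₁ x₂ x₃ x₄ : L) :
    ⁅⁅⁅x₁, x₂⁆, x₃⁆, x₄⁆ + ⁅⁅⁅x₃, x₁⁆, x₂⁆, x₄⁆ + ⁅⁅⁅x₂, x₁⁆, x₄⁆, x₃⁆ +
      ⁅⁅⁅x₄, x₂⁆, x₁⁆, x₃⁆ + ⁅⁅⁅x₁, x₃⁆, x₄⁆, x₂⁆ + ⁅⁅⁅x₃, x₄⁆, x₁⁆, x₂⁆ +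
      ⁅⁅⁅x₂, x₃⁆, x₄⁆, x₁⁆ = 0 := by
  have jacobi (a b c : L) : ⁅⁅a, b⁆, c⁆ + ⁅⁅c, a⁆, b⁆ = -⁅⁅b, c⁆, a⁆ := by
    rw [lie_lie a b c, ← lie_skew a ⁅b, c⁆, ← lie_skew ⁅c, a⁆ b, ← lie_skew c a, lie_neg]
    abel
  have commutator (u a b : L) : ⁅⁅u, a⁆, b⁆ - ⁅⁅u, b⁆, a⁆ = ⁅u, ⁅a, b⁆⁆ := by
    rw [leibniz_lie u a b, ← lie_skew a ⁅u, b⁆]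
    abel
  calc
    _ = ⁅⁅⁅x₁, x₂⁆, x₃⁆ + ⁅⁅x₃, x₁⁆, x₂⁆, x₄⁆ + ⁅⁅⁅x₂, x₁⁆, x₄⁆ + ⁅⁅x₄, x₂⁆, x₁⁆, x₃⁆ +
        ⁅⁅⁅x₁, x₃⁆, x₄⁆ + ⁅⁅x₃, x₄⁆, x₁⁆, x₂⁆ + ⁅⁅⁅x₂, x₃⁆, x₄⁆, x₁⁆ := by
      simp only [add_lie]
      abel
    _ = (⁅⁅⁅x₂, x₃⁆, x₄⁆, x₁⁆ - ⁅⁅⁅x₂, x₃⁆, x₁⁆, x₄⁆) +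
        (⁅⁅⁅x₁, x₄⁆, x₃⁆, x₂⁆ - ⁅⁅⁅x₁, x₄⁆, x₂⁆, x₃⁆) := by
      rw [jacobi x₁ x₂ x₃, jacobi x₂ x₁ x₄, add_comm ⁅⁅x₁, x₃⁆, x₄⁆, jacobi x₃ x₄ x₁,
        ← lie_skew x₄ x₁]
      simp only [neg_lie, neg_neg]
      abel
    _ = 0 := by
      rw [commutator, commutator, ← lie_skew x₄ x₁, ← lie_skew x₃ x₂, lie_neg, lie_neg, lie_skew]
      exact add_neg_cancel _
end

section
/- Let n ≥ 1 and let T ⊆ Sₙ. Then T is a Jacobi subset if and only if for every τ ∈ Sₙ one has |T ∩ τ·Iₙ⁺| = |T ∩ τ·Iₙ⁻|, where τ·Iₙ^± = {τ·π : π ∈ Iₙ^±}. -/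
/-- The left-normed bracket `[x₁, …, xₙ] = [[x₁, …, x_{n-1}], xₙ]` in a Lie ring
(with the conventions `[x₁] = x₁` and value `0` for `n = 0`). -/
def lnb {L : Type*} [LieRing L] : (n : ℕ) → (Fin n → L) → L
  | 0, _ => 0
  | 1, x => x 0
  | n + 2, x => ⁅lnb (n + 1) (fun k => x k.castSucc), x (Fin.last (n + 1))⁆

/-- A subset `T ⊆ Sₙ` is Jacobi if `∑_{σ ∈ T} [x_{σ(1)}, …, x_{σ(n)}] = 0`
holds for all elements `x₁, …, xₙ` of any Lie ring. -/
def IsJacobiSubset {n : ℕ} (T : Finset (Equiv.Perm (Fin n))) : Prop :=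
  ∀ (L : Type*) [LieRing L] (x : Fin n → L),
    ∑ σ ∈ T, lnb n (fun k => x (σ k)) = 0

/-- `(α, β)` is an `(s, t)`-shuffle (with values in `{0, …, n-1}`, `s + t = n`) with
`α(0) = 0` — i.e. a member of `Sh¹(s, t)`. -/
def IsSh1 (n s t : ℕ) (α : Fin s → Fin n) (β : Fin t → Fin n) : Prop :=
  s + t = n ∧ StrictMono α ∧ StrictMono β ∧ (∀ a b, α a ≠ β b) ∧
    ∀ h : 0 < s, (α ⟨0, h⟩ : ℕ) = 0

/-- `π = π_{α,β,i}` sends positions `0, …, i-1` to `β(i-1), …, β(0)` and positions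
`i, …, n-1` to `α(0), …, α(n-i-1)` (0-indexed version of the paper's permutation). -/
def IsPiPerm (n i : ℕ) (α : Fin (n - i) → Fin n) (β : Fin i → Fin n)
    (π : Equiv.Perm (Fin n)) : Prop :=
  (∀ (k : Fin i) (hk : (k : ℕ) < n) (hk' : i - 1 - (k : ℕ) < i),
      π ⟨(k : ℕ), hk⟩ = β ⟨i - 1 - (k : ℕ), hk'⟩) ∧
  (∀ (k : Fin (n - i)) (hk : i + (k : ℕ) < n), π ⟨i + (k : ℕ), hk⟩ = α k)

/-- `Iₙ⁺ = {π_{α,β,i}⁻¹ : (α,β) ∈ Sh¹(n-i,i), 0 ≤ i ≤ n-1, i even}`. -/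
def Iplus (n : ℕ) : Set (Equiv.Perm (Fin n)) :=
  {ρ | ∃ i : Fin n, Even (i : ℕ) ∧
    ∃ (α : Fin (n - (i : ℕ)) → Fin n) (β : Fin (i : ℕ) → Fin n),
      IsSh1 n (n - (i : ℕ)) (i : ℕ) α β ∧ IsPiPerm n (i : ℕ) α β ρ⁻¹}

/-- `Iₙ⁻ = {π_{α,β,i}⁻¹ : (α,β) ∈ Sh¹(n-i,i), 0 ≤ i ≤ n-1, i odd}`. -/
def Iminus (n : ℕ) : Set (Equiv.Perm (Fin n)) :=
  {ρ | ∃ i : Fin n, Odd (i : ℕ) ∧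
    ∃ (α : Fin (n - (i : ℕ)) → Fin n) (β : Fin (i : ℕ) → Fin n),
      IsSh1 n (n - (i : ℕ)) (i : ℕ) α β ∧ IsPiPerm n (i : ℕ) α β ρ⁻¹}

/-- The free associative ring on `X`, as the ring of words with integer coefficients. -/
abbrev WordRing (X : Type*) := MonoidAlgebra ℤ (FreeMonoid X)

noncomputable instance (X : Type*) : LieRing (WordRing X) := LieRing.ofAssociativeRing

namespace WordRing

variable {X : Type*} {L : Type*} [LieRing L]

/-- The one-letter word `b`. -/
noncomputable def gen (b : X) : WordRing X := MonoidAlgebra.single (FreeMonoid.of b) 1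

theorem coeff_mul_gen [DecidableEq X] (Q : WordRing X) (w : List X) (b : X) :
    (Q * gen b).coeff (FreeMonoid.ofList w) =
      if w.getLast? = some b then Q.coeff (FreeMonoid.ofList w.dropLast) else 0 := by
  split_ifs with h
  · obtain ⟨w, rfl⟩ := List.getLast?_eq_some_iff.1 h
    rw [gen, MonoidAlgebra.coeff_mul_single_eq_coeff_mul (FreeMonoid.ofList w), mul_one,
      List.dropLast_concat]
    intro m' _
    exact List.append_left_inj (s₁ := FreeMonoid.toList m') (s₂ := w) [b]
  · rw [gen, MonoidAlgebra.coeff_mul_single_of_forall_mul_ne]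
    rintro d rfl
    exact h (List.getLast?_concat (l := FreeMonoid.toList d))

theorem coeff_gen_mul [DecidableEq X] (Q : WordRing X) (w : List X) (b : X) :
    (gen b * Q).coeff (FreeMonoid.ofList w) =
      if w.head? = some b then Q.coeff (FreeMonoid.ofList w.tail) else 0 := by
  split_ifs with h
  · obtain ⟨w, rfl⟩ := List.head?_eq_some_iff.1 h
    rw [gen, MonoidAlgebra.coeff_single_mul_eq_mul_coeff (FreeMonoid.ofList w), one_mul,
      List.tail_cons]
    intro m' _
    exact List.cons_inj_right (l := FreeMonoid.toList m') (l' := w) b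
  · rw [gen, MonoidAlgebra.coeff_single_mul_of_forall_mul_ne]
    rintro d rfl
    exact h rfl

theorem coeff_gen [DecidableEq X] (b : X) (w : List X) :
    (gen b).coeff (FreeMonoid.ofList w) = if w = [b] then 1 else 0 := by
  classical
  rw [gen, MonoidAlgebra.coeff_single, Finsupp.single_apply]
  exact if_congr eq_comm rfl rfl

/-- The additive map on `WordRing X` with prescribed values on words. -/
noncomputable def wordLift (φ : List X → L) : WordRing X →+ L :=
  (Finsupp.linearCombination ℤ fun w : FreeMonoid X => φ w.toList).toAddMonoidHom.comp
    MonoidAlgebra.coeffAddEquiv.toAddMonoidHom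

@[simp]
theorem wordLift_single (φ : List X → L) (w : FreeMonoid X) (r : ℤ) :
    wordLift φ (MonoidAlgebra.single w r) = r • φ w.toList := by
  simp [wordLift]

/-- The additive map sending a word `b₁ ⋯ bₖ` to `[v, x b₁, …, x bₖ]`. -/
noncomputable def act (x : X → L) (v : L) : WordRing X →+ L :=
  wordLift fun w => w.foldl (fun u c => ⁅u, x c⁆) v

theorem act_mul_gen (x : X → L) (v : L) (Q : WordRing X) (b : X) :
    act x v (Q * gen b) = ⁅act x v Q, x b⁆ := by
  induction Q using MonoidAlgebra.induction_linear with
  | zero => simp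
  | add f g hf hg => simp [add_mul, hf, hg]
  | single w r => simp [act, gen, MonoidAlgebra.single_mul_single]

theorem act_gen_mul (x : X → L) (v : L) (Q : WordRing X) (b : X) :
    act x v (gen b * Q) = act x ⁅v, x b⁆ Q := by
  induction Q using MonoidAlgebra.induction_linear with
  | zero => simp
  | add f g hf hg => simp [mul_add, hf, hg]
  | single w r => simp [act, gen, MonoidAlgebra.single_mul_single]

theorem act_lnb (x : X → L) {m : ℕ} (y : Fin (m + 1) → X) (v : L) :
    act x v (lnb (m + 1) fun k => gen (y k)) = ⁅v, lnb (m + 1) fun k => x (y k)⁆ := by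
  induction m generalizing v with
  | zero => simp [lnb, act, gen]
  | succ m ih =>
    have h := ih fun k => y k.castSucc
    simp only [lnb] at h ⊢
    rw [LieRing.of_associative_ring_bracket, map_sub, act_mul_gen, act_gen_mul, h, h,
      leibniz_lie v, ← lie_skew _ ⁅v, x _⁆, sub_eq_add_neg]

/-- The additive map sending a word `a b₁ ⋯ bₖ` to `[x a, x b₁, …, x bₖ]`, and every word not
starting with `a` to zero. -/
noncomputable def headEval [DecidableEq X] (x : X → L) (a : X) : WordRing X →+ L :=
  wordLift fun w => if w.head? = some a then w.tail.foldl (fun u c => ⁅u, x c⁆) (x a) else 0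

variable [DecidableEq X]

theorem headEval_gen_mul (x : X → L) (a b : X) (Q : WordRing X) :
    headEval x a (gen b * Q) = if b = a then act x (x a) Q else 0 := by
  induction Q using MonoidAlgebra.induction_linear with
  | zero => simp
  | add f g hf hg => split_ifs at * <;> simp [mul_add, hf, hg]
  | single w r => split_ifs with h <;> simp [act, headEval, gen, MonoidAlgebra.single_mul_single, h]

theorem headEval_mul_gen (x : X → L) {a b : X} (hb : b ≠ a) (Q : WordRing X) :
    headEval x a (Q * gen b) = ⁅headEval x a Q, x b⁆ := by
  induction Q using MonoidAlgebra.induction_linear with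
  | zero => simp
  | add f g hf hg => simp [add_mul, hf, hg]
  | single w r =>
    rcases h : FreeMonoid.toList w with _ | ⟨c, w'⟩
    · simp [headEval, gen, MonoidAlgebra.single_mul_single, h, hb]
    · by_cases hc : c = a <;>
        simp [headEval, gen, MonoidAlgebra.single_mul_single, h, hc]

theorem headEval_lnb_mul (x : X → L) {a : X} {m : ℕ} (y : Fin (m + 1) → X) (ha : ∀ k, y k ≠ a)
    (Q : WordRing X) : headEval x a ((lnb (m + 1) fun k => gen (y k)) * Q) = 0 := by
  induction m generalizing Q with
  | zero => simp [lnb, headEval_gen_mul, ha]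
  | succ m ih =>
    simp only [lnb]
    rw [LieRing.of_associative_ring_bracket, sub_mul, map_sub, mul_assoc, mul_assoc,
      headEval_gen_mul, if_neg (ha _), ih (fun k => y k.castSucc) fun k => ha _, sub_zero]

theorem headEval_lnb (x : X → L) {m : ℕ} (y : Fin (m + 1) → X) (hy : Function.Injective y)
    (i : Fin (m + 1)) :
    headEval x (y i) (lnb (m + 1) fun k => gen (y k)) = lnb (m + 1) fun k => x (y k) := by
  induction m with
  | zero =>
    obtain rfl : i = 0 := Fin.fin_one_eq_zero i
    simp [lnb, headEval, gen]
  | succ m ih =>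
    simp only [lnb]
    rw [LieRing.of_associative_ring_bracket, map_sub, headEval_gen_mul]
    induction i using Fin.lastCases with
    | last =>
      rw [if_pos rfl, headEval_lnb_mul x (fun k => y k.castSucc), act_lnb x fun k => y k.castSucc,
        zero_sub, lie_skew]
      exact fun k hk => (Fin.castSucc_lt_last k).ne (hy hk)
    | cast i =>
      have hne : y (Fin.last _) ≠ y i.castSucc := fun h => (Fin.castSucc_lt_last i).ne' (hy h)
      rw [if_neg hne, headEval_mul_gen x hne, sub_zero,
        ih (fun k => y k.castSucc) (hy.comp (Fin.castSucc_injective _))]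

theorem coeff_lnb_of_not_perm {m : ℕ} (y : Fin m → X) {w : List X} (hw : ¬ w.Perm (List.ofFn y)) :
    (lnb m fun k => gen (y k)).coeff (FreeMonoid.ofList w) = 0 := by
  match m, y, hw with
  | 0, _, _ => simp [lnb]
  | 1, y, hw =>
    rw [lnb, coeff_gen, if_neg]
    rintro rfl
    simp at hw
  | m + 2, y, hw =>
    have ih := fun w => coeff_lnb_of_not_perm (w := w) fun k : Fin (m + 1) => y k.castSucc
    rw [lnb, LieRing.of_associative_ring_bracket, MonoidAlgebra.coeff_sub, Finsupp.sub_apply]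
    rw [coeff_mul_gen, coeff_gen_mul]
    rw [List.ofFn_succ_last] at hw
    refine (congrArg₂ (· - ·) ?_ ?_).trans (sub_zero 0)
    · split_ifs with h
      · obtain ⟨w, rfl⟩ := List.getLast?_eq_some_iff.1 h
        rw [ih]
        rw [List.dropLast_concat]
        exact fun h => hw (h.append_right _)
      · rfl
    · split_ifs with h
      · obtain ⟨w, rfl⟩ := List.head?_eq_some_iff.1 h
        exact ih _ fun h => hw ((h.cons _).trans (List.perm_append_singleton _ _).symm)
      · rfl

end WordRing

/-- A word in the natural numbers that decreases for `k` letters down to a letter `0`, after which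
it increases. -/
def IsValley (k : ℕ) (w : List ℕ) : Prop :=
  ∃ u v, w = u ++ 0 :: v ∧ u.length = k ∧ u.Pairwise (· > ·) ∧ v.Pairwise (· < ·)

namespace IsValley

theorem idxOf_zero {k : ℕ} {w : List ℕ} (hw : w.Nodup) (hk : IsValley k w) : w.idxOf 0 = k := by
  obtain ⟨u, v, rfl, rfl, -, -⟩ := hk
  have h0 : 0 ∉ u := fun h => (List.nodup_append.1 hw).2.2 0 h 0 (by simp) rfl
  simp [List.idxOf_append_of_notMem h0]

variable {m k : ℕ} {w : List ℕ}

theorem concat (hw : IsValley k w) (hm : ∀ a ∈ w, a < m) : IsValley k (w ++ [m]) := by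
  obtain ⟨u, v, rfl, rfl, hu, hv⟩ := hw
  refine ⟨u, v ++ [m], by simp, rfl, hu, List.pairwise_append.2 ⟨hv, by simp, ?_⟩⟩
  simp_all

theorem cons (hw : IsValley k w) (hm : ∀ a ∈ w, a < m) : IsValley (k + 1) (m :: w) := by
  obtain ⟨u, v, rfl, rfl, hu, hv⟩ := hw
  refine ⟨m :: u, v, by simp, rfl, List.pairwise_cons.2 ⟨?_, hu⟩, hv⟩
  simp_all

theorem concat_or_cons (hw : IsValley k w) (hm : 0 < m) (hmem : m ∈ w) (hle : ∀ a ∈ w, a ≤ m) :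
    (∃ w', w = w' ++ [m] ∧ IsValley k w') ∨
      ∃ w' k', w = m :: w' ∧ k = k' + 1 ∧ IsValley k' w' := by
  obtain ⟨u, v, rfl, rfl, hu, hv⟩ := hw
  rcases List.mem_append.1 hmem with h | h
  · right
    rcases u with _ | ⟨a, u⟩
    · simp at h
    · rw [List.pairwise_cons] at hu
      have ham : a = m := by
        refine (hle a (by simp)).antisymm ?_
        rcases List.mem_cons.1 h with h | h
        · exact h.le
        · exact (hu.1 m h).le
      subst ham
      exact ⟨u ++ 0 :: v, u.length, by simp, by simp, u, v, rfl, rfl, hu.2, hv⟩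
  · left
    rcases v.eq_nil_or_concat with rfl | ⟨v, a, rfl⟩
    · simp [hm.ne'] at h
    · rw [List.concat_eq_append] at *
      rw [List.pairwise_append] at hv
      have hma : m ∈ v ++ [a] := (List.mem_cons.1 h).resolve_left hm.ne'
      have ham : a = m := by
        refine (hle a (by simp)).antisymm ?_
        rcases List.mem_append.1 hma with h | h
        · exact (hv.2.2 m h a (by simp)).le
        · exact (List.mem_singleton.1 h).le
      subst ham
      exact ⟨u ++ 0 :: v, by simp, u, v, rfl, rfl, hu, hv.1⟩

end IsValley

namespace WordRing

variable {X : Type*} [DecidableEq X]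

theorem coeff_lnb {m : ℕ} {y : ℕ → X} (hy : Set.InjOn y (Set.Iic m)) {w : List ℕ}
    (hw : w.Perm (List.range (m + 1))) :
    (∀ k, IsValley k w → (lnb (m + 1) fun k => gen (y k)).coeff (FreeMonoid.ofList (w.map y)) =
      (-1) ^ k) ∧
    ((∀ k, ¬ IsValley k w) →
      (lnb (m + 1) fun k => gen (y k)).coeff (FreeMonoid.ofList (w.map y)) = 0) := by
  induction m generalizing w with
  | zero =>
    obtain rfl : w = [0] := by simpa using hw
    have h0 : IsValley 0 [0] := ⟨[], [], by simp⟩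
    refine ⟨fun k hk => ?_, fun h => (h 0 h0).elim⟩
    rw [← hk.idxOf_zero (by simp)]
    simp [lnb, gen]
  | succ m ih =>
    have hy' : Set.InjOn y (Set.Iic m) := hy.mono (Set.Iic_subset_Iic.2 m.le_succ)
    have hmem : ∀ a, a ∈ w ↔ a < m + 2 := fun a => by simp [hw.mem_iff, Nat.lt_succ_iff]
    have hnd : w.Nodup := hw.nodup_iff.2 List.nodup_range
    have hiff : ∀ a ∈ w, y a = y (m + 1) ↔ a = m + 1 := fun a ha =>
      ⟨fun h => hy (Nat.lt_succ_iff.1 ((hmem a).1 ha)) (Set.mem_Iic.2 le_rfl) h, fun h => h ▸ rfl⟩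
    have hmul : (lnb (m + 2) fun k => gen (y k)).coeff (FreeMonoid.ofList (w.map y)) =
        (if w.getLast? = some (m + 1) then (lnb (m + 1) fun k => gen (y k)).coeff
          (FreeMonoid.ofList (w.dropLast.map y)) else 0) -
        if w.head? = some (m + 1) then (lnb (m + 1) fun k => gen (y k)).coeff
          (FreeMonoid.ofList (w.tail.map y)) else 0 := by
      rw [lnb, LieRing.of_associative_ring_bracket, MonoidAlgebra.coeff_sub, Finsupp.sub_apply,
        coeff_mul_gen, coeff_gen_mul, ← List.map_dropLast, ← List.map_tail]
      congr 1
      · refine if_congr ?_ rfl rfl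
        rw [List.getLast?_map]
        rcases h : w.getLast? with _ | a
        · simp
        · simpa using hiff a (List.mem_of_getLast? h)
      · refine if_congr ?_ rfl rfl
        rw [List.head?_map]
        rcases h : w.head? with _ | a
        · simp
        · simpa using hiff a (List.mem_of_head? h)
    rw [hmul]
    by_cases hlast : ∃ w', w = w' ++ [m + 1]
    · obtain ⟨w, rfl⟩ := hlast
      have hp : w.Perm (List.range (m + 1)) := by
        rwa [List.range_succ (n := m + 1), List.perm_append_right_iff] at hw
      have hhead : (w ++ [m + 1]).head? ≠ some (m + 1) := by
        rcases w with _ | ⟨a, w⟩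
        · simpa using hp.length_eq
        · have := hp.mem_iff.1 List.mem_cons_self
          simp only [List.mem_range] at this
          simpa using this.ne
      rw [if_pos (by simp), if_neg hhead, sub_zero, List.dropLast_concat]
      refine ⟨fun k hk => ?_, fun h => ?_⟩
      · obtain ⟨w', h, hk'⟩ | ⟨w', k', h, -, -⟩ := hk.concat_or_cons m.succ_pos (by simp)
          fun a ha => Nat.lt_succ_iff.1 ((hmem a).1 ha)
        · rw [(List.append_left_inj _).1 h]
          exact (ih hy' (by rwa [← (List.append_left_inj _).1 h])).1 k hk'
        · simp [h] at hhead
      · exact (ih hy' hp).2 fun k hk => h k (hk.concat fun a ha => by simpa using hp.mem_iff.1 ha)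
    · rw [if_neg (by simpa [List.getLast?_eq_some_iff] using hlast), zero_sub]
      by_cases hhead : ∃ w', w = (m + 1) :: w'
      · obtain ⟨w, rfl⟩ := hhead
        have hp : w.Perm (List.range (m + 1)) := by
          rw [List.range_succ (n := m + 1)] at hw
          exact (hw.trans (List.perm_append_singleton _ _)).cons_inv
        rw [if_pos (by simp), List.tail_cons]
        refine ⟨fun k hk => ?_, fun h => ?_⟩
        · obtain ⟨w', h, hk'⟩ | ⟨w', k', h, rfl, hk'⟩ := hk.concat_or_cons m.succ_pos (by simp)
            fun a ha => Nat.lt_succ_iff.1 ((hmem a).1 ha)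
          · exact (hlast ⟨_, h⟩).elim
          · rw [List.cons_inj_right] at h
            subst h
            rw [(ih hy' hp).1 _ hk', pow_succ, mul_neg_one]
        · rw [(ih hy' hp).2 fun k hk =>
            h _ (hk.cons fun a ha => by simpa using hp.mem_iff.1 ha), neg_zero]
      · rw [if_neg (by simpa [List.head?_eq_some_iff] using hhead), neg_zero]
        refine ⟨fun k hk => ?_, fun _ => rfl⟩
        obtain ⟨w', h, -⟩ | ⟨w', k', h, -⟩ := hk.concat_or_cons m.succ_pos
          ((hmem _).2 (Nat.lt_succ_self _)) fun a ha => Nat.lt_succ_iff.1 ((hmem a).1 ha)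
        · exact (hlast ⟨_, h⟩).elim
        · exact (hhead ⟨_, h⟩).elim

end WordRing

theorem isValley_ofFn_iff {n : ℕ} (π : Equiv.Perm (Fin n)) (i : ℕ) :
    IsValley i (List.ofFn fun k => (π k : ℕ)) ↔
      i < n ∧ ∃ (α : Fin (n - i) → Fin n) (β : Fin i → Fin n),
        IsSh1 n (n - i) i α β ∧ IsPiPerm n i α β π := by
  constructor
  · rintro ⟨u, v, h, rfl, hu, hv⟩
    have hlen : n = u.length + (v.length + 1) := by simpa using congrArg List.length h
    have hval : ∀ (k : ℕ) (hk : k < n), (π ⟨k, hk⟩ : ℕ) = (u ++ 0 :: v)[k]'(by simp; omega) := by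
      intro k hk
      simp [← h]
    have hi : u.length < n := by omega
    have h0 : (π ⟨u.length, hi⟩ : ℕ) = 0 := by simp [hval]
    refine ⟨hi, fun k => π ⟨u.length + k, by omega⟩, fun k => π ⟨u.length - 1 - k, by omega⟩,
      ⟨by omega, ?_, ?_, ?_, ?_⟩, ?_, ?_⟩
    · rintro ⟨a, ha⟩ ⟨b, hb⟩ hab
      rw [Fin.mk_lt_mk] at hab
      obtain ⟨b, rfl⟩ := Nat.exists_eq_add_one_of_ne_zero (Nat.ne_zero_of_lt hab)
      rw [Fin.lt_def]
      rcases a with _ | a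
      · refine h0.trans_lt (Nat.pos_of_ne_zero fun hb0 => ?_)
        have := congrArg Fin.val (π.injective (Fin.ext (hb0.trans h0.symm)))
        simp at this
      · rw [hval, hval]
        simpa using List.pairwise_iff_getElem.1 hv a b (by omega) (by omega) (by omega)
    · rintro ⟨a, ha⟩ ⟨b, hb⟩ hab
      rw [Fin.mk_lt_mk] at hab
      rw [Fin.lt_def, hval, hval, List.getElem_append_left (by omega),
        List.getElem_append_left (by omega)]
      exact List.pairwise_iff_getElem.1 hu (u.length - 1 - b) (u.length - 1 - a)
        (by omega) (by omega) (by omega)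
    · intro a b hab
      have := congrArg Fin.val (π.injective hab)
      simp only at this
      omega
    · intro h
      exact h0
    · intro k hk hk'
      congr 2
      simp only
      omega
    · intro k hk
      rfl
  · rintro ⟨hi, α, β, ⟨-, hα, hβ, -, h0⟩, hπβ, hπα⟩
    have hzero : (List.ofFn fun k => (π k : ℕ))[i]'(by simpa using hi) = 0 := by
      rw [List.getElem_ofFn, ← h0 (by omega), ← hπα ⟨0, by omega⟩ hi]
      rfl
    refine ⟨(List.ofFn fun k => (π k : ℕ)).take i, (List.ofFn fun k => (π k : ℕ)).drop (i + 1),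
      ?_, by simpa using hi.le, ?_, ?_⟩
    · rw [← hzero, ← List.drop_eq_getElem_cons, List.take_append_drop]
    · refine List.pairwise_iff_getElem.2 fun a b ha hb hab => ?_
      simp only [List.length_take, List.length_ofFn, lt_min_iff] at ha hb
      simp only [List.getElem_take, List.getElem_ofFn]
      rw [hπβ ⟨a, ha.1⟩ ha.2 (by simp only; omega), hπβ ⟨b, hb.1⟩ hb.2 (by simp only; omega)]
      exact hβ (Fin.mk_lt_mk.2 (by simp only; omega))
    · refine List.pairwise_iff_getElem.2 fun a b ha hb hab => ?_
      simp only [List.length_drop, List.length_ofFn] at ha hb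
      simp only [List.getElem_drop, List.getElem_ofFn, add_assoc]
      rw [hπα ⟨1 + a, by omega⟩ (by simp only; omega), hπα ⟨1 + b, by omega⟩ (by simp only; omega)]
      exact hα (Fin.mk_lt_mk.2 (by omega))

theorem mem_Iplus_iff {n : ℕ} {ρ : Equiv.Perm (Fin n)} :
    ρ ∈ Iplus n ↔ ∃ i, Even i ∧ IsValley i (List.ofFn fun k => (ρ⁻¹ k : ℕ)) := by
  simp only [isValley_ofFn_iff]
  exact ⟨fun ⟨i, he, h⟩ => ⟨i, he, i.2, h⟩, fun ⟨i, he, hi, h⟩ => ⟨⟨i, hi⟩, he, h⟩⟩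

theorem mem_Iminus_iff {n : ℕ} {ρ : Equiv.Perm (Fin n)} :
    ρ ∈ Iminus n ↔ ∃ i, Odd i ∧ IsValley i (List.ofFn fun k => (ρ⁻¹ k : ℕ)) := by
  simp only [isValley_ofFn_iff]
  exact ⟨fun ⟨i, he, h⟩ => ⟨i, he, i.2, h⟩, fun ⟨i, he, hi, h⟩ => ⟨⟨i, hi⟩, he, h⟩⟩

theorem nodup_ofFn_perm {n : ℕ} (π : Equiv.Perm (Fin n)) :
    (List.ofFn fun k => (π k : ℕ)).Nodup :=
  List.nodup_ofFn.2 (Fin.val_injective.comp π.injective)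

theorem perm_range_ofFn_perm {n : ℕ} (π : Equiv.Perm (Fin n)) :
    (List.ofFn fun k => (π k : ℕ)).Perm (List.range n) := by
  refine (List.perm_ext_iff_of_nodup (nodup_ofFn_perm π) List.nodup_range).2 fun a => ?_
  simp only [List.mem_ofFn, List.mem_range]
  exact ⟨fun ⟨k, hk⟩ => hk ▸ (π k).2, fun ha => ⟨π⁻¹ ⟨a, ha⟩, by simp⟩⟩

namespace WordRing

variable {X : Type*} [DecidableEq X]

open Classical in
theorem coeff_lnb_perm {m : ℕ} {e : Fin (m + 1) → X} (he : Function.Injective e)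
    (σ τ : Equiv.Perm (Fin (m + 1))) :
    (lnb (m + 1) fun k => gen (e (σ k))).coeff (FreeMonoid.ofList (List.ofFn fun k => e (τ k))) =
      (if τ⁻¹ * σ ∈ Iplus (m + 1) then 1 else 0) - if τ⁻¹ * σ ∈ Iminus (m + 1) then 1 else 0 := by
  have hinj : Set.InjOn (fun k : ℕ => e (σ (Fin.ofNat (m + 1) k))) (Set.Iic m) := by
    intro a ha b hb hab
    have := congrArg Fin.val (σ.injective (he hab))
    simpa [Nat.mod_eq_of_lt (Nat.lt_succ_iff.2 ha), Nat.mod_eq_of_lt (Nat.lt_succ_iff.2 hb)]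
      using this
  have key := coeff_lnb hinj (perm_range_ofFn_perm (τ⁻¹ * σ)⁻¹)
  have hword : (List.ofFn fun k => (((τ⁻¹ * σ)⁻¹ k : Fin (m + 1)) : ℕ)).map
      (fun k : ℕ => e (σ (Fin.ofNat (m + 1) k))) = List.ofFn fun k => e (τ k) := by
    rw [List.map_ofFn]
    congr 1
    funext k
    simp
  simp only [hword, Fin.ofNat_val_eq_self] at key
  have hval := fun {i} => IsValley.idxOf_zero (k := i) (nodup_ofFn_perm (τ⁻¹ * σ)⁻¹)
  rw [mem_Iplus_iff, mem_Iminus_iff]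
  by_cases h : ∃ i, IsValley i (List.ofFn fun k => (((τ⁻¹ * σ)⁻¹ k : Fin (m + 1)) : ℕ))
  · obtain ⟨i, hi⟩ := h
    rw [key.1 i hi]
    rcases Nat.even_or_odd i with hev | hodd
    · rw [hev.neg_one_pow, if_pos ⟨i, hev, hi⟩, if_neg, sub_zero]
      rintro ⟨j, hj, hj'⟩
      rw [← hval hj', hval hi] at hj
      exact Nat.not_odd_iff_even.2 hev hj
    · have hne : ¬ ∃ j, Even j ∧
          IsValley j (List.ofFn fun k => (((τ⁻¹ * σ)⁻¹ k : Fin (m + 1)) : ℕ)) := by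
        rintro ⟨j, hj, hj'⟩
        rw [← hval hj', hval hi] at hj
        exact Nat.not_even_iff_odd.2 hodd hj
      rw [hodd.neg_one_pow, if_neg hne, if_pos ⟨i, hodd, hi⟩, zero_sub]
  · rw [key.2 (not_exists.1 h), if_neg fun ⟨i, _, hi⟩ => h ⟨i, hi⟩,
      if_neg fun ⟨i, _, hi⟩ => h ⟨i, hi⟩, sub_zero]

theorem coeff_sum_lnb {m : ℕ} {e : Fin (m + 1) → X} (he : Function.Injective e)
    (T : Finset (Equiv.Perm (Fin (m + 1)))) (τ : Equiv.Perm (Fin (m + 1))) :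
    (∑ σ ∈ T, lnb (m + 1) fun k => gen (e (σ k))).coeff
        (FreeMonoid.ofList (List.ofFn fun k => e (τ k))) =
      (((T : Set (Equiv.Perm (Fin (m + 1)))) ∩ ((fun π => τ * π) '' Iplus (m + 1))).ncard : ℤ) -
        ((T : Set (Equiv.Perm (Fin (m + 1)))) ∩ ((fun π => τ * π) '' Iminus (m + 1))).ncard := by
  classical
  have hcard (I : Set (Equiv.Perm (Fin (m + 1)))) :
      (((T : Set (Equiv.Perm (Fin (m + 1)))) ∩ ((fun π => τ * π) '' I)).ncard : ℤ) =
        ∑ σ ∈ T, if τ⁻¹ * σ ∈ I then 1 else 0 := by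
    rw [Finset.sum_boole, ← Set.ncard_coe_finset]
    congr 2
    ext σ
    simp
  rw [hcard, hcard, ← Finset.sum_sub_distrib, MonoidAlgebra.coeff_sum, Finsupp.finsetSum_apply]
  exact Finset.sum_congr rfl fun σ _ => coeff_lnb_perm he σ τ

theorem sum_lnb_eq_zero_iff {m : ℕ} {e : Fin (m + 1) → X} (he : Function.Injective e)
    (T : Finset (Equiv.Perm (Fin (m + 1)))) :
    ∑ σ ∈ T, lnb (m + 1) (fun k => gen (e (σ k))) = 0 ↔
      ∀ τ : Equiv.Perm (Fin (m + 1)),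
        ((T : Set (Equiv.Perm (Fin (m + 1)))) ∩ ((fun π => τ * π) '' Iplus (m + 1))).ncard =
          ((T : Set (Equiv.Perm (Fin (m + 1)))) ∩ ((fun π => τ * π) '' Iminus (m + 1))).ncard := by
  constructor
  · intro h τ
    have := coeff_sum_lnb he T τ
    rw [h, MonoidAlgebra.coeff_zero, Finsupp.zero_apply] at this
    exact_mod_cast (sub_eq_zero.1 this.symm)
  · intro h
    ext w
    rw [MonoidAlgebra.coeff_zero, Finsupp.zero_apply]
    by_cases hw : ∃ τ : Equiv.Perm (Fin (m + 1)),
        w = FreeMonoid.ofList (List.ofFn fun k => e (τ k))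
    · obtain ⟨τ, rfl⟩ := hw
      rw [coeff_sum_lnb he, h, sub_self]
    · rw [MonoidAlgebra.coeff_sum, Finsupp.finsetSum_apply]
      refine Finset.sum_eq_zero fun σ _ => coeff_lnb_of_not_perm (w := w.toList) _ fun hp => hw ?_
      obtain ⟨f, hf, hf'⟩ : ∃ f : Fin (m + 1) → Fin (m + 1), Function.Injective f ∧
          w.toList = List.ofFn fun k => e (f k) := by
        have hlen : w.toList.length = m + 1 := by simpa using hp.length_eq
        have hmem : ∀ k : Fin (m + 1), ∃ j, e j = w.toList[k] := fun k => by
          have hk : (k : ℕ) < w.toList.length := by omega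
          obtain ⟨j, hj⟩ := List.mem_ofFn.1 (hp.mem_iff.1 (List.getElem_mem hk))
          exact ⟨_, hj⟩
        choose f hf using hmem
        have hnd : w.toList.Nodup := hp.nodup_iff.2 (List.nodup_ofFn.2 (he.comp σ.injective))
        refine ⟨f, fun a b hab => ?_, ?_⟩
        · have := (hf a).symm.trans ((congrArg e hab).trans (hf b))
          exact Fin.ext ((hnd.getElem_inj_iff).1 this)
        · simp only [hf]
          exact List.ext_getElem (by simpa using hlen) fun i h₁ h₂ => by rw [List.getElem_ofFn]; rfl
      exact ⟨Equiv.ofBijective f (Finite.injective_iff_bijective.1 hf), hf'⟩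

end WordRing

theorem isJacobiSubset_iff_sum_lnb_gen_eq_zero.{u} {m : ℕ}
    (T : Finset (Equiv.Perm (Fin (m + 1)))) :
    IsJacobiSubset.{u} T ↔
      ∑ σ ∈ T, lnb (m + 1) (fun k => WordRing.gen (ULift.up.{u} (σ k))) = 0 := by
  refine ⟨fun h => h (WordRing (ULift.{u} (Fin (m + 1)))) fun k => WordRing.gen (ULift.up k),
    fun h L _ x => ?_⟩
  have := congrArg (WordRing.headEval (fun k => x k.down) (ULift.up 0)) h
  rw [map_sum, map_zero] at this
  rw [← this]
  refine Finset.sum_congr rfl fun σ _ => ?_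
  have key := WordRing.headEval_lnb (fun k => x k.down) (fun k => ULift.up.{u} (σ k))
    (ULift.up_injective.comp σ.injective) (σ⁻¹ 0)
  simpa using key.symm

/-- `T ⊆ Sₙ` is a Jacobi subset if and only if `|T ∩ τIₙ⁺| = |T ∩ τIₙ⁻|`
for every `τ ∈ Sₙ`. -/
theorem isJacobiSubset_iff_card_inter (n : ℕ) (hn : 1 ≤ n)
    (T : Finset (Equiv.Perm (Fin n))) :
    IsJacobiSubset T ↔
      ∀ τ : Equiv.Perm (Fin n),
        ((T : Set (Equiv.Perm (Fin n))) ∩ ((fun π => τ * π) '' Iplus n)).ncard =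
          ((T : Set (Equiv.Perm (Fin n))) ∩ ((fun π => τ * π) '' Iminus n)).ncard := by
  obtain ⟨m, rfl⟩ := Nat.exists_eq_add_one_of_ne_zero (Nat.ne_zero_of_lt hn)
  rw [isJacobiSubset_iff_sum_lnb_gen_eq_zero,
    WordRing.sum_lnb_eq_zero_iff ULift.up_injective]
end
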